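/- (Proposition 4.2.) Assume the generative factorization p(x,y) = ∑_{gI,g₋} μ(gI)·ν(g₋)·c(y|g₋)·d(x|gI,g₋), that the joint pmf p is strictly positive, and that the encoder e is strictly positive. Then concept leakage is sandwiched between the two mutual informations: I(M;Y) ≤ Λ(e) ≤ I(G₋;Y), where I(M;Y) is computed from the induced joint P(m,y) = ∑_x p(x,y)·e(m|x) and I(G₋;Y) from the joint ν(g₋)·c(y|g₋). -/

import Mathlib

open Finset

/-- The concept-leakage log-likelihood
`L_CL(e,q) = ∑_{x,y} p(x,y) · log (∑_m q(y|m) · e(m|x))`. -/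
noncomputable def LCL {X Y M : Type*} [Fintype X] [Fintype Y] [Fintype M]
    (p : X → Y → ℝ) (e : X → M → ℝ) (q : M → Y → ℝ) : ℝ :=
  ∑ x, ∑ y, p x y * Real.log (∑ m, q m y * e x m)

/-- The label marginal `p_Y(y) = ∑_x p(x,y)`. -/
noncomputable def pY {X Y : Type*} [Fintype X] (p : X → Y → ℝ) (y : Y) : ℝ :=
  ∑ x, p x y

/-- The induced representation–label joint pmf `P(m,y) = ∑_x p(x,y) · e(m|x)`. -/
noncomputable def Pjoint {X Y M : Type*} [Fintype X]
    (p : X → Y → ℝ) (e : X → M → ℝ) (m : M) (y : Y) : ℝ :=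
  ∑ x, p x y * e x m

/-- The representation marginal `P_M(m) = ∑_y P(m,y)`. -/
noncomputable def PM {X Y M : Type*} [Fintype X] [Fintype Y]
    (p : X → Y → ℝ) (e : X → M → ℝ) (m : M) : ℝ :=
  ∑ y, Pjoint p e m y

/-- Mutual information `I(M;Y)` of the induced joint. -/
noncomputable def MI {X Y M : Type*} [Fintype X] [Fintype Y] [Fintype M]
    (p : X → Y → ℝ) (e : X → M → ℝ) : ℝ :=
  ∑ m, ∑ y, Pjoint p e m y * Real.log (Pjoint p e m y / (PM p e m * pY p y))

/-- Achievable concept-leakage log-likelihoods over strictly positive classifiers. -/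
noncomputable def clSet {X Y M : Type*} [Fintype X] [Fintype Y] [Fintype M]
    (p : X → Y → ℝ) (e : X → M → ℝ) : Set ℝ :=
  {L : ℝ | ∃ q : M → Y → ℝ, (∀ m y, 0 < q m y) ∧ (∀ m, ∑ y, q m y = 1) ∧
    L = LCL p e q}

/-- Achievable uninformed log-likelihoods over strictly positive pmfs on `Y`. -/
noncomputable def unSet {X Y : Type*} [Fintype X] [Fintype Y]
    (p : X → Y → ℝ) : Set ℝ :=
  {L : ℝ | ∃ r : Y → ℝ, (∀ y, 0 < r y) ∧ (∑ y, r y = 1) ∧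
    L = ∑ y, pY p y * Real.log (r y)}

/-- Concept leakage `Λ(e)`. -/
noncomputable def Lam {X Y M : Type*} [Fintype X] [Fintype Y] [Fintype M]
    (p : X → Y → ℝ) (e : X → M → ℝ) : ℝ :=
  sSup (clSet p e) - sSup (unSet p)

/-- Mutual information `I(G₋;Y)` between the label-relevant generative factors and the
label, computed from the joint `ν(g₋)·c(y|g₋)`. -/
noncomputable def IGY {X Y Gm : Type*} [Fintype X] [Fintype Gm]
    (p : X → Y → ℝ) (ν : Gm → ℝ) (c : Gm → Y → ℝ) [Fintype Y] : ℝ :=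
  ∑ gm, ∑ y, ν gm * c gm y * Real.log (c gm y / pY p y)

/-- Gibbs' inequality: the cross log-likelihood is maximized by the true distribution. -/
lemma gibbs_inequality {T : Type*} [Fintype T] (a b : T → ℝ) (ha : ∀ t, 0 ≤ a t)
    (hb : ∀ t, 0 < b t) (hab : ∑ t, b t = ∑ t, a t) :
    ∑ t, a t * Real.log (b t) ≤ ∑ t, a t * Real.log (a t) := by
  have key : ∀ t, a t * Real.log (b t) ≤ a t * Real.log (a t) + (b t - a t) := by
    intro t
    rcases (ha t).eq_or_lt with h | h
    · simpa [← h] using (hb t).le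
    · have h1 := mul_le_mul_of_nonneg_left
        (Real.log_le_sub_one_of_pos (div_pos (hb t) h)) h.le
      rw [Real.log_div (hb t).ne' h.ne', mul_sub, mul_sub, mul_div_cancel₀ _ h.ne'] at h1
      linarith
  calc ∑ t, a t * Real.log (b t) ≤ ∑ t, (a t * Real.log (a t) + (b t - a t)) :=
        sum_le_sum fun t _ => key t
    _ = ∑ t, a t * Real.log (a t) := by
        rw [sum_add_distrib, sum_sub_distrib, hab, sub_self, add_zero]

/-- Jensen's inequality for the logarithm of a finite mixture. -/
lemma sum_mul_log_le_log_sum {T : Type*} [Fintype T] (w q : T → ℝ) (hw : ∀ t, 0 ≤ w t)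
    (hw1 : ∑ t, w t = 1) (hq : ∀ t, 0 < q t) :
    ∑ t, w t * Real.log (q t) ≤ Real.log (∑ t, q t * w t) := by
  have h := strictConcaveOn_log_Ioi.concaveOn.le_map_sum (t := univ) (w := w) (p := q)
    (fun t _ => hw t) hw1 (fun t _ => hq t)
  simpa [smul_eq_mul, mul_comm] using h

/-- The best uninformed log-likelihood is `-H(Y)`, attained at the label marginal. -/
lemma sSup_unSet {X Y : Type*} [Fintype X] [Fintype Y] (p : X → Y → ℝ)
    (hpos : ∀ y, 0 < pY p y) (hsum : ∑ y, pY p y = 1) :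
    sSup (unSet p) = ∑ y, pY p y * Real.log (pY p y) := by
  refine IsGreatest.csSup_eq ⟨⟨pY p, hpos, hsum, rfl⟩, ?_⟩
  rintro _ ⟨r, hr, hr1, rfl⟩
  exact gibbs_inequality _ _ (fun y => (hpos y).le) hr (hr1.trans hsum.symm)

/-- The concept-leakage log-likelihood of a positive classifier is at least the
log-likelihood of the labels under the induced joint. -/
lemma sum_Pjoint_mul_log_le_LCL {X Y M : Type*} [Fintype X] [Fintype Y] [Fintype M]
    (p : X → Y → ℝ) (hp : ∀ x y, 0 ≤ p x y) (e : X → M → ℝ) (he : ∀ x m, 0 ≤ e x m)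
    (he_sum : ∀ x, ∑ m, e x m = 1) (q : M → Y → ℝ) (hq : ∀ m y, 0 < q m y) :
    ∑ m, ∑ y, Pjoint p e m y * Real.log (q m y) ≤ LCL p e q := by
  calc ∑ m, ∑ y, Pjoint p e m y * Real.log (q m y)
      = ∑ x, ∑ y, p x y * ∑ m, e x m * Real.log (q m y) := by
        simp only [Pjoint, sum_mul, mul_sum, ← mul_assoc]
        calc ∑ m, ∑ y, ∑ x, p x y * e x m * Real.log (q m y)
            = ∑ m, ∑ x, ∑ y, p x y * e x m * Real.log (q m y) :=
              sum_congr rfl fun m _ => sum_comm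
          _ = ∑ x, ∑ m, ∑ y, p x y * e x m * Real.log (q m y) := sum_comm
          _ = ∑ x, ∑ y, ∑ m, p x y * e x m * Real.log (q m y) :=
              sum_congr rfl fun x _ => sum_comm
    _ ≤ LCL p e q := sum_le_sum fun x _ => sum_le_sum fun y _ =>
        mul_le_mul_of_nonneg_left
          (sum_mul_log_le_log_sum _ _ (he x) (he_sum x) fun m => hq m y) (hp x y)

/-- If labels and inputs are conditionally independent given a factor `g`, the
concept-leakage log-likelihood is at most `-H(Y|G)`. -/
lemma LCL_le_sum_mul_log {X Y M G : Type*} [Fintype X] [Fintype Y] [Fintype M] [Fintype G]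
    [Nonempty M] (p : X → Y → ℝ) (e : X → M → ℝ) (he : ∀ x m, 0 < e x m)
    (he_sum : ∀ x, ∑ m, e x m = 1) (ν : G → ℝ) (hν : ∀ g, 0 ≤ ν g)
    (c : G → Y → ℝ) (hc : ∀ g y, 0 ≤ c g y) (hc_sum : ∀ g, ∑ y, c g y = 1)
    (D : G → X → ℝ) (hD : ∀ g x, 0 ≤ D g x) (hD_sum : ∀ g, ∑ x, D g x = 1)
    (hfact : ∀ x y, p x y = ∑ g, ν g * c g y * D g x)
    (q : M → Y → ℝ) (hq : ∀ m y, 0 < q m y) (hq_sum : ∀ m, ∑ y, q m y = 1) :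
    LCL p e q ≤ ∑ g, ν g * ∑ y, c g y * Real.log (c g y) := by
  have hmix_sum : ∀ x, ∑ y, ∑ m, q m y * e x m = 1 := fun x => by
    rw [sum_comm]
    simp only [← sum_mul, hq_sum, one_mul, he_sum]
  calc LCL p e q
      = ∑ g, ν g * ∑ x, D g x * ∑ y, c g y * Real.log (∑ m, q m y * e x m) := by
        have h : ∀ x, ∑ y, p x y * Real.log (∑ m, q m y * e x m) =
            ∑ g, ν g * (D g x * ∑ y, c g y * Real.log (∑ m, q m y * e x m)) := fun x => by
          simp only [hfact, sum_mul]
          rw [sum_comm]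
          simp only [mul_sum]
          exact sum_congr rfl fun g _ => sum_congr rfl fun y _ => by ring
        simp only [LCL, h]
        rw [sum_comm]
        simp only [mul_sum]
    _ ≤ ∑ g, ν g * ∑ x, D g x * ∑ y, c g y * Real.log (c g y) := by
        refine sum_le_sum fun g _ => mul_le_mul_of_nonneg_left
          (sum_le_sum fun x _ => mul_le_mul_of_nonneg_left ?_ (hD g x)) (hν g)
        exact gibbs_inequality _ _ (hc g)
          (fun y => sum_pos (fun m _ => mul_pos (hq m y) (he x m)) univ_nonempty)
          ((hmix_sum x).trans (hc_sum g).symm)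
    _ = ∑ g, ν g * ∑ y, c g y * Real.log (c g y) := by
        simp only [← sum_mul, hD_sum, one_mul]

/-- `I(M;Y)` is the gain of the Bayes classifier's log-likelihood over `-H(Y)`. -/
lemma MI_eq_sub {X Y M : Type*} [Fintype X] [Fintype Y] [Fintype M]
    (p : X → Y → ℝ) (e : X → M → ℝ) (he_sum : ∀ x, ∑ m, e x m = 1)
    (hP : ∀ m y, 0 < Pjoint p e m y) (hPM : ∀ m, 0 < PM p e m) (hY : ∀ y, 0 < pY p y) :
    MI p e = ∑ m, ∑ y, Pjoint p e m y * Real.log (Pjoint p e m y / PM p e m) -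
      ∑ y, pY p y * Real.log (pY p y) := by
  have hmarg : ∀ y, ∑ m, Pjoint p e m y = pY p y := fun y => by
    simp only [Pjoint, pY]
    rw [sum_comm]
    simp only [← mul_sum, he_sum, mul_one]
  have hH : ∑ y, pY p y * Real.log (pY p y) =
      ∑ m, ∑ y, Pjoint p e m y * Real.log (pY p y) := by
    rw [sum_comm]
    simp only [← sum_mul, hmarg]
  rw [hH]
  simp only [MI, ← sum_sub_distrib, ← mul_sub]
  refine sum_congr rfl fun m _ => sum_congr rfl fun y _ => ?_
  rw [← div_div, Real.log_div (div_pos (hP m y) (hPM m)).ne' (hY y).ne']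

/-- `I(G;Y) = H(Y) - H(Y|G)`. -/
lemma IGY_eq_sub {X Y G : Type*} [Fintype X] [Fintype Y] [Fintype G]
    (p : X → Y → ℝ) (ν : G → ℝ) (c : G → Y → ℝ) (hY : ∀ y, 0 < pY p y)
    (hmarg : ∀ y, pY p y = ∑ g, ν g * c g y) :
    IGY p ν c = ∑ g, ν g * ∑ y, c g y * Real.log (c g y) -
      ∑ y, pY p y * Real.log (pY p y) := by
  have hH : ∑ y, pY p y * Real.log (pY p y) =
      ∑ g, ∑ y, ν g * c g y * Real.log (pY p y) := by
    rw [sum_comm]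
    simp only [← sum_mul, ← hmarg]
  rw [hH]
  simp only [IGY, mul_sum, ← sum_sub_distrib]
  refine sum_congr rfl fun g _ => sum_congr rfl fun y _ => ?_
  by_cases h : c g y = 0
  · simp [h]
  · rw [Real.log_div h (hY y).ne']
    ring

/-- Proposition 4.2.  Under the generative factorization
`p(x,y) = ∑_{gI,g₋} μ(gI)·ν(g₋)·c(y|g₋)·d(x|gI,g₋)`, with `p` and the encoder `e`
strictly positive, concept leakage is sandwiched between the two mutual informations:
`I(M;Y) ≤ Λ(e) ≤ I(G₋;Y)`. -/
theorem leakage_sandwich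
    {X Y M GI Gm : Type*} [Fintype X] [Fintype Y] [Fintype M] [Fintype GI] [Fintype Gm]
    [Nonempty X] [Nonempty Y] [Nonempty M] [Nonempty GI] [Nonempty Gm]
    (p : X → Y → ℝ) (hp_pos : ∀ x y, 0 < p x y) (hp_sum : ∑ x, ∑ y, p x y = 1)
    (e : X → M → ℝ) (he_pos : ∀ x m, 0 < e x m) (he_sum : ∀ x, ∑ m, e x m = 1)
    (μ : GI → ℝ) (hμ_nonneg : ∀ gI, 0 ≤ μ gI) (hμ_sum : ∑ gI, μ gI = 1)
    (ν : Gm → ℝ) (hν_nonneg : ∀ gm, 0 ≤ ν gm) (hν_sum : ∑ gm, ν gm = 1)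
    (c : Gm → Y → ℝ) (hc_nonneg : ∀ gm y, 0 ≤ c gm y) (hc_sum : ∀ gm, ∑ y, c gm y = 1)
    (d : GI → Gm → X → ℝ) (hd_nonneg : ∀ gI gm x, 0 ≤ d gI gm x)
    (hd_sum : ∀ gI gm, ∑ x, d gI gm x = 1)
    (hfact : ∀ x y, p x y = ∑ gI, ∑ gm, μ gI * ν gm * c gm y * d gI gm x) :
    MI p e ≤ Lam p e ∧ Lam p e ≤ IGY p ν c := by
  have hY : ∀ y, 0 < pY p y := fun y => sum_pos (fun x _ => hp_pos x y) univ_nonempty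
  have hY_sum : ∑ y, pY p y = 1 := by
    simp only [pY]
    rw [sum_comm, hp_sum]
  have hP : ∀ m y, 0 < Pjoint p e m y := fun m y =>
    sum_pos (fun x _ => mul_pos (hp_pos x y) (he_pos x m)) univ_nonempty
  have hPM : ∀ m, 0 < PM p e m := fun m => sum_pos (fun y _ => hP m y) univ_nonempty
  let D : Gm → X → ℝ := fun g x => ∑ gI, μ gI * d gI g x
  have hD : ∀ g x, 0 ≤ D g x := fun g x =>
    sum_nonneg fun gI _ => mul_nonneg (hμ_nonneg gI) (hd_nonneg gI g x)
  have hD_sum : ∀ g, ∑ x, D g x = 1 := fun g => by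
    simp only [D]
    rw [sum_comm]
    simp only [← mul_sum, hd_sum, mul_one, hμ_sum]
  have hfactD : ∀ x y, p x y = ∑ g, ν g * c g y * D g x := fun x y => by
    rw [hfact, sum_comm]
    simp only [D, mul_sum]
    exact sum_congr rfl fun g _ => sum_congr rfl fun gI _ => by ring
  have hmarg : ∀ y, pY p y = ∑ g, ν g * c g y := fun y => by
    simp only [pY, hfactD]
    rw [sum_comm]
    simp only [← mul_sum, hD_sum, mul_one]
  have hub : ∀ L ∈ clSet p e, L ≤ ∑ g, ν g * ∑ y, c g y * Real.log (c g y) := by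
    rintro _ ⟨q, hq, hq_sum, rfl⟩
    exact LCL_le_sum_mul_log p e he_pos he_sum ν hν_nonneg c hc_nonneg hc_sum D hD hD_sum
      hfactD q hq hq_sum
  let bayes : M → Y → ℝ := fun m y => Pjoint p e m y / PM p e m
  have hbayes : ∀ m y, 0 < bayes m y := fun m y => div_pos (hP m y) (hPM m)
  have hmem : LCL p e bayes ∈ clSet p e := ⟨bayes, hbayes, fun m => by
    simp only [bayes]
    rw [← sum_div]
    exact div_self (hPM m).ne', rfl⟩
  rw [Lam, sSup_unSet p hY hY_sum, MI_eq_sub p e he_sum hP hPM hY, IGY_eq_sub p ν c hY hmarg]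
  constructor
  · exact sub_le_sub_right ((sum_Pjoint_mul_log_le_LCL p (fun x y => (hp_pos x y).le) e
      (fun x m => (he_pos x m).le) he_sum bayes hbayes).trans (le_csSup ⟨_, hub⟩ hmem)) _
  · exact sub_le_sub_right (csSup_le ⟨_, hmem⟩ hub) _
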